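/- arXiv:2601.13726 — 2 statements merged into one kernel-verified Lean document; each statement's English description precedes it below -/
import Mathlib

section
/- Fix c ∈ (0,1) and set V_{p,q}(m) := Vol(p^{-1}·a(m)Δ_c ∩ q^{-1}·Δ_c) for m ∈ ℤ² and p, q ∈ ℕ. There is a constant C_c, depending only on c, such that Σ_{m∈ℤ²} Σ_{p,q∈ℕ} V_{p,q}(m) ≤ C_c·Σ_{m∈ℤ²} e^{-max(|m₁|,|m₂|)/2}; in particular the triple series Σ_{m∈ℤ²} Σ_{p,q∈ℕ} V_{p,q}(m) converges. -/
open MeasureTheory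
open scoped ENNReal Pointwise

noncomputable section

/-- `Δ_c = {0 < |x₁x₂|·y ≤ 1, e⁻¹c < |x₁|,|x₂| ≤ c}`. -/
def DeltaC (c : ℝ) : Set (ℝ × ℝ × ℝ) :=
  {v | 0 < |v.1 * v.2.1| * v.2.2 ∧ |v.1 * v.2.1| * v.2.2 ≤ 1 ∧
    (Real.exp 1)⁻¹ * c < |v.1| ∧ |v.1| ≤ c ∧
    (Real.exp 1)⁻¹ * c < |v.2.1| ∧ |v.2.1| ≤ c}

/-- The diagonal map `a(t)(x₁,x₂,y) = (e^{t₁}x₁, e^{t₂}x₂, e^{-t₁-t₂}y)`. -/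
def aMap (t : ℝ × ℝ) (x : ℝ × ℝ × ℝ) : ℝ × ℝ × ℝ :=
  (Real.exp t.1 * x.1, Real.exp t.2 * x.2.1, Real.exp (-t.1 - t.2) * x.2.2)

/-- `V_{p,q}(m) = Vol(p⁻¹·a(m)Δ_c ∩ q⁻¹·Δ_c)`. -/
def Vpq (c : ℝ) (m : ℤ × ℤ) (p q : ℕ+) : ℝ≥0∞ :=
  volume ((((p : ℕ) : ℝ)⁻¹ • (aMap ((m.1 : ℝ), (m.2 : ℝ)) '' DeltaC c)) ∩
    (((q : ℕ) : ℝ)⁻¹ • DeltaC c))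

lemma abs_log_div_sub_lt_one {c P Q a b m : ℝ} (hc : 0 < c) (hP : 0 < P) (hQ : 0 < Q)
    (ha : (Real.exp 1)⁻¹ * c < a) (ha' : a ≤ c) (hb : (Real.exp 1)⁻¹ * c < b) (hb' : b ≤ c)
    (h : P * b = Q * (Real.exp m * a)) : |Real.log (P / Q) - m| < 1 := by
  have hec : 0 < (Real.exp 1)⁻¹ * c := by positivity
  have ha0 : 0 < a := hec.trans ha
  have hb0 : 0 < b := hec.trans hb
  have hl := congrArg Real.log h
  rw [Real.log_mul hP.ne' hb0.ne', Real.log_mul hQ.ne' (by positivity),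
    Real.log_mul (Real.exp_ne_zero _) ha0.ne', Real.log_exp] at hl
  have hlow : Real.log ((Real.exp 1)⁻¹ * c) = -1 + Real.log c := by
    rw [Real.log_mul (by positivity) hc.ne', Real.log_inv, Real.log_exp]
  have h1 := Real.log_lt_log hec ha
  have h2 := Real.log_lt_log hec hb
  have h3 := Real.log_le_log ha0 ha'
  have h4 := Real.log_le_log hb0 hb'
  rw [Real.log_div hP.ne' hQ.ne', abs_lt]
  constructor <;> linarith

/-- The two integers that can lie at distance less than `1` from `x`. -/
def nearbyInts (x : ℝ) : Finset ℤ := {⌊x⌋, ⌊x⌋ + 1}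

lemma mem_nearbyInts {x : ℝ} {m : ℤ} (h : |x - m| < 1) : m ∈ nearbyInts x := by
  rw [abs_lt] at h
  have h1 : m < ⌊x⌋ + 2 := by
    have := Int.lt_floor_add_one x
    have : (m : ℝ) < ((⌊x⌋ + 2 : ℤ) : ℝ) := by push_cast; linarith
    exact_mod_cast this
  have h2 : ⌊x⌋ < m + 1 := by
    have := Int.floor_le x
    have : ((⌊x⌋ : ℤ) : ℝ) < ((m + 1 : ℤ) : ℝ) := by push_cast; linarith
    exact_mod_cast this
  simp only [nearbyInts, Finset.mem_insert, Finset.mem_singleton]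
  lia

lemma card_nearbyInts_product_le (x : ℝ) : (nearbyInts x ×ˢ nearbyInts x).card ≤ 4 := by
  rw [Finset.card_product]
  have h : (nearbyInts x).card ≤ 2 := Finset.card_le_two
  exact Nat.mul_le_mul h h

lemma le_rpow_mul_rpow_of_mul_pow_le_one {t P Q : ℝ} (ht : 0 ≤ t) (hP : 0 < P) (hQ : 0 < Q)
    (h1 : P ^ 3 * t ≤ 1) (h2 : Q ^ 3 * t ≤ 1) :
    t ≤ P ^ (-(3 / 2) : ℝ) * Q ^ (-(3 / 2) : ℝ) := by
  refine (sq_le_sq₀ ht (by positivity)).1 ?_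
  have key : ∀ x : ℝ, 0 < x → (x ^ (-(3 / 2) : ℝ)) ^ 2 = (x ^ 3)⁻¹ := by
    intro x hx
    rw [← Real.rpow_natCast, ← Real.rpow_mul hx.le, ← Real.rpow_natCast x 3,
      ← Real.rpow_neg hx.le]
    norm_num
  rw [mul_pow, key P hP, key Q hQ, sq]
  have h1' : t ≤ (P ^ 3)⁻¹ := by
    rw [← one_div, le_div_iff₀ (by positivity)]; linarith
  have h2' : t ≤ (Q ^ 3)⁻¹ := by
    rw [← one_div, le_div_iff₀ (by positivity)]; linarith
  exact mul_le_mul h1' h2' ht (by positivity)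

/-- Coordinate constraints on a point of `p⁻¹·a(m)Δ_c ∩ q⁻¹·Δ_c`. -/
lemma bounds_of_mem_inter {c P Q : ℝ} (hc : 0 < c) (hP : 0 < P) (hQ : 0 < Q) {t z}
    (hz : z ∈ (P⁻¹ • (aMap t '' DeltaC c)) ∩ (Q⁻¹ • DeltaC c)) :
    |Real.log (P / Q) - t.1| < 1 ∧ |Real.log (P / Q) - t.2| < 1 ∧
    |z.1| ≤ c / Q ∧ |z.2.1| ≤ c / Q ∧ 0 ≤ z.2.2 ∧
    z.2.2 ≤ (Real.exp 1 * Q / c) ^ 2 * (P ^ (-(3 / 2) : ℝ) * Q ^ (-(3 / 2) : ℝ)) := by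
  obtain ⟨x₁, x₂, y⟩ := z
  obtain ⟨t₁, t₂⟩ := t
  obtain ⟨hz1, hz2⟩ := hz
  rw [Set.mem_inv_smul_set_iff₀ hP.ne'] at hz1
  rw [Set.mem_inv_smul_set_iff₀ hQ.ne'] at hz2
  obtain ⟨⟨w₁, w₂, v⟩, ⟨hw0, hw1, ha1, ha1', ha2, ha2'⟩, hw⟩ := hz1
  obtain ⟨hq0, hq1, hb1, hb1', hb2, hb2'⟩ := hz2
  simp only [aMap, Prod.smul_mk, smul_eq_mul, Prod.mk.injEq] at hw hw0 hw1 ha1 ha1' ha2 ha2'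
  simp only [Prod.smul_mk, smul_eq_mul] at hq0 hq1 hb1 hb1' hb2 hb2'
  obtain ⟨e1, e2, e3⟩ := hw
  have f1 : P * |x₁| = Real.exp t₁ * |w₁| := by
    have := congrArg abs e1
    simpa [abs_mul, abs_of_pos hP] using this.symm
  have f2 : P * |x₂| = Real.exp t₂ * |w₂| := by
    have := congrArg abs e2
    simpa [abs_mul, abs_of_pos hP] using this.symm
  rw [abs_mul] at hw0 hw1 hq0 hq1
  rw [abs_mul, abs_of_pos hQ] at hb1 hb1' hb2 hb2'
  rw [abs_mul, abs_mul, abs_of_pos hQ] at hq0 hq1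
  have hp : P ^ 3 * (|x₁| * |x₂| * y) = |w₁| * |w₂| * v := by
    have : Real.exp t₁ * Real.exp t₂ * Real.exp (-t₁ - t₂) = 1 := by
      rw [← Real.exp_add, ← Real.exp_add]; simp
    calc P ^ 3 * (|x₁| * |x₂| * y) = (P * |x₁|) * (P * |x₂|) * (P * y) := by ring
      _ = (Real.exp t₁ * Real.exp t₂ * Real.exp (-t₁ - t₂)) * (|w₁| * |w₂| * v) := by
        rw [f1, f2, ← e3]; ring
      _ = _ := by rw [this, one_mul]
  have hec : 0 < (Real.exp 1)⁻¹ * c := by positivity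
  have hq : Q ^ 3 * (|x₁| * |x₂| * y) = Q * |x₁| * (Q * |x₂|) * (Q * y) := by ring
  have hT : 0 < |x₁| * |x₂| * y := by
    rw [← hq] at hq0
    exact pos_of_mul_pos_right hq0 (by positivity)
  have hx : (c / (Real.exp 1 * Q)) ^ 2 ≤ |x₁| * |x₂| := by
    have hlow : ∀ x : ℝ, (Real.exp 1)⁻¹ * c < Q * x → c / (Real.exp 1 * Q) ≤ x := by
      intro x hx
      rw [div_le_iff₀ (by positivity)]
      rw [inv_mul_lt_iff₀ (by positivity)] at hx
      linarith
    rw [sq]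
    exact mul_le_mul (hlow _ hb1) (hlow _ hb2) (by positivity) (abs_nonneg _)
  have hy : 0 < y := pos_of_mul_pos_right hT (by positivity)
  refine ⟨abs_log_div_sub_lt_one hc hP hQ ha1 ha1' hb1 hb1' ?_,
    abs_log_div_sub_lt_one hc hP hQ ha2 ha2' hb2 hb2' ?_, ?_, ?_, hy.le, ?_⟩
  · rw [← f1]; ring
  · rw [← f2]; ring
  · rw [le_div_iff₀ hQ]; linarith
  · rw [le_div_iff₀ hQ]; linarith
  · have hb := le_rpow_mul_rpow_of_mul_pow_le_one hT.le hP hQ (hp.trans_le hw1) (hq.trans_le hq1)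
    calc y = (Real.exp 1 * Q / c) ^ 2 * ((c / (Real.exp 1 * Q)) ^ 2 * y) := by
          field_simp
      _ ≤ (Real.exp 1 * Q / c) ^ 2 * (|x₁| * |x₂| * y) := by gcongr
      _ ≤ _ := by gcongr

lemma volume_inter_le {c P Q : ℝ} (hc : 0 < c) (hP : 0 < P) (hQ : 0 < Q) (t : ℝ × ℝ) :
    volume ((P⁻¹ • (aMap t '' DeltaC c)) ∩ (Q⁻¹ • DeltaC c)) ≤
      ENNReal.ofReal (4 * Real.exp 1 ^ 2 * (P ^ (-(3 / 2) : ℝ) * Q ^ (-(3 / 2) : ℝ))) := by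
  set B := P ^ (-(3 / 2) : ℝ) * Q ^ (-(3 / 2) : ℝ)
  calc _ ≤ volume (Set.Icc (-(c / Q)) (c / Q) ×ˢ Set.Icc (-(c / Q)) (c / Q) ×ˢ
        Set.Icc 0 ((Real.exp 1 * Q / c) ^ 2 * B)) := by
        refine measure_mono fun z hz => ?_
        obtain ⟨-, -, h1, h2, h3, h4⟩ := bounds_of_mem_inter hc hP hQ hz
        exact ⟨abs_le.1 h1, abs_le.1 h2, h3, h4⟩
    _ = _ := by
        rw [Measure.volume_eq_prod, Measure.prod_prod, Measure.volume_eq_prod, Measure.prod_prod,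
          Real.volume_Icc, Real.volume_Icc, ← ENNReal.ofReal_mul (by simp; positivity),
          ← ENNReal.ofReal_mul (by simp; positivity)]
        congr 1
        field_simp
        ring

lemma tsum_Vpq_le {c : ℝ} (hc : 0 < c) (p q : ℕ+) :
    ∑' m : ℤ × ℤ, Vpq c m p q ≤ 4 * ENNReal.ofReal (4 * Real.exp 1 ^ 2 *
      (((p : ℕ) : ℝ) ^ (-(3 / 2) : ℝ) * ((q : ℕ) : ℝ) ^ (-(3 / 2) : ℝ))) := by
  have hP : (0 : ℝ) < ((p : ℕ) : ℝ) := by exact_mod_cast p.pos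
  have hQ : (0 : ℝ) < ((q : ℕ) : ℝ) := by exact_mod_cast q.pos
  set L := Real.log (((p : ℕ) : ℝ) / ((q : ℕ) : ℝ)) with hL
  rw [tsum_eq_sum (s := nearbyInts L ×ˢ nearbyInts L)]
  · refine (Finset.sum_le_card_nsmul _ _ _ fun m _ => volume_inter_le hc hP hQ _).trans ?_
    rw [nsmul_eq_mul]
    gcongr
    exact_mod_cast card_nearbyInts_product_le L
  · intro m hm
    refine (congrArg volume (Set.eq_empty_of_forall_notMem fun z hz => ?_)).trans measure_empty
    obtain ⟨h1, h2, -⟩ := bounds_of_mem_inter hc hP hQ hz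
    exact hm (Finset.mem_product.2 ⟨mem_nearbyInts h1, mem_nearbyInts h2⟩)

lemma tsum_ofReal_pnat_rpow_ne_top :
    ∑' n : ℕ+, ENNReal.ofReal (((n : ℕ) : ℝ) ^ (-(3 / 2) : ℝ)) ≠ ⊤ := by
  have h : Summable fun n : ℕ => (n : ℝ) ^ (-(3 / 2) : ℝ) :=
    Real.summable_nat_rpow.2 (by norm_num)
  exact (h.comp_injective PNat.coe_injective).tsum_ofReal_ne_top

lemma tsum_tsum_tsum_Vpq_ne_top {c : ℝ} (hc : 0 < c) :
    ∑' m : ℤ × ℤ, ∑' p : ℕ+, ∑' q : ℕ+, Vpq c m p q ≠ ⊤ := by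
  have hswap : ∑' m : ℤ × ℤ, ∑' p : ℕ+, ∑' q : ℕ+, Vpq c m p q =
      ∑' p : ℕ+, ∑' q : ℕ+, ∑' m : ℤ × ℤ, Vpq c m p q := by
    rw [ENNReal.tsum_comm]
    exact tsum_congr fun p => ENNReal.tsum_comm
  rw [hswap]
  refine ne_top_of_le_ne_top ?_
    (ENNReal.tsum_le_tsum fun p => ENNReal.tsum_le_tsum fun q => tsum_Vpq_le hc p q)
  have hmul : ∀ p q : ℕ+, 4 * ENNReal.ofReal (4 * Real.exp 1 ^ 2 *
      (((p : ℕ) : ℝ) ^ (-(3 / 2) : ℝ) * ((q : ℕ) : ℝ) ^ (-(3 / 2) : ℝ))) =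
      4 * ENNReal.ofReal (4 * Real.exp 1 ^ 2) * (ENNReal.ofReal (((p : ℕ) : ℝ) ^ (-(3 / 2) : ℝ)) *
        ENNReal.ofReal (((q : ℕ) : ℝ) ^ (-(3 / 2) : ℝ))) := fun p q => by
    rw [ENNReal.ofReal_mul (by positivity), ENNReal.ofReal_mul (p := (_ : ℝ) ^ (_ : ℝ))
      (by positivity), mul_assoc]
  simp_rw [hmul, ENNReal.tsum_mul_left, ENNReal.tsum_mul_right]
  have h := tsum_ofReal_pnat_rpow_ne_top
  exact ENNReal.mul_ne_top (ENNReal.mul_ne_top (by simp) ENNReal.ofReal_ne_top)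
    (ENNReal.mul_ne_top h h)

theorem stmt16 (c : ℝ) (hc : c ∈ Set.Ioo (0:ℝ) 1) :
    (∃ C > 0,
      (∑' m : ℤ × ℤ, ∑' p : ℕ+, ∑' q : ℕ+, Vpq c m p q) ≤
        ENNReal.ofReal C *
          ∑' m : ℤ × ℤ, ENNReal.ofReal
            (Real.exp (-((max |m.1| |m.2| : ℤ) : ℝ) / 2))) ∧
    (∑' m : ℤ × ℤ, ∑' p : ℕ+, ∑' q : ℕ+, Vpq c m p q) ≠ ⊤ := by
  have hfin := tsum_tsum_tsum_Vpq_ne_top hc.1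
  refine ⟨?_, hfin⟩
  set S := ∑' m : ℤ × ℤ, ∑' p : ℕ+, ∑' q : ℕ+, Vpq c m p q
  refine ⟨S.toReal + 1, by positivity, ?_⟩
  have hone : 1 ≤ ∑' m : ℤ × ℤ, ENNReal.ofReal
      (Real.exp (-((max |m.1| |m.2| : ℤ) : ℝ) / 2)) :=
    le_trans (by simp) (ENNReal.le_tsum (0 : ℤ × ℤ))
  calc S = ENNReal.ofReal S.toReal := (ENNReal.ofReal_toReal hfin).symm
    _ ≤ ENNReal.ofReal (S.toReal + 1) * 1 := by
      rw [mul_one]; exact ENNReal.ofReal_le_ofReal (by linarith)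
    _ ≤ _ := by gcongr

end
end

section
/- Fix c ∈ (0,1) and K > 2. For Lebesgue-almost every x = (x₁,x₂) ∈ [0,1)², there are only finitely many integers q ≥ 2 for which there exist p₁, p₂ ∈ ℤ with |qx₁−p₁|·|qx₂−p₂| ≤ (ln q)^{-K}·q^{-1} and |qx₁−p₁| ≤ c, |qx₂−p₂| ≤ c. -/
open MeasureTheory

noncomputable section

/-- The unit box `[0,1)²`. -/
def box2 : Set (ℝ × ℝ) := Set.Ico (0:ℝ) 1 ×ˢ Set.Ico (0:ℝ) 1

/-- The points `x` of `[0,1)²` for which some `p₁, p₂ ∈ ℤ` satisfy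
`|q x₁ - p₁| |q x₂ - p₂| ≤ ε` with both factors at most `c`. -/
def approxSet (c ε : ℝ) (q : ℕ) : Set (ℝ × ℝ) :=
  {x | x ∈ box2 ∧ ∃ p₁ p₂ : ℤ,
    |(q : ℝ) * x.1 - (p₁ : ℝ)| * |(q : ℝ) * x.2 - (p₂ : ℝ)| ≤ ε ∧
    |(q : ℝ) * x.1 - (p₁ : ℝ)| ≤ c ∧ |(q : ℝ) * x.2 - (p₂ : ℝ)| ≤ c}

theorem exists_dyadic_scale {u : ℝ} (hu : u ≤ 1) (J : ℕ) :
    (∃ j < J, (2 ^ (j + 1) : ℝ)⁻¹ < u ∧ u ≤ (2 ^ j : ℝ)⁻¹) ∨ u ≤ (2 ^ J : ℝ)⁻¹ := by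
  induction J with
  | zero => right; simpa using hu
  | succ J ih =>
    rcases ih with ⟨j, hj, h⟩ | h
    · exact Or.inl ⟨j, by omega, h⟩
    · rcases le_or_gt u (2 ^ (J + 1) : ℝ)⁻¹ with h' | h'
      · exact Or.inr h'
      · exact Or.inl ⟨J, by omega, h', h⟩

/-- The hyperbolic region `u v ≤ ε` in the unit square is covered by `J + 1` dyadic rectangles,
each of area `2 ε`. -/
theorem exists_dyadic_rectangle {u v ε : ℝ} {J : ℕ} (hu : u ≤ 1) (hv₀ : 0 ≤ v) (hv : v ≤ 1)
    (huv : u * v ≤ ε) (hJ : 1 ≤ 2 ^ J * ε) :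
    ∃ j ∈ Finset.range (J + 1), u ≤ (2 ^ j : ℝ)⁻¹ ∧ v ≤ 2 ^ (j + 1) * ε := by
  rcases exists_dyadic_scale hu J with ⟨j, hj, h₁, h₂⟩ | h
  · refine ⟨j, Finset.mem_range.2 (by omega), h₂, ?_⟩
    have h : (2 ^ (j + 1) : ℝ)⁻¹ * v ≤ ε := (mul_le_mul_of_nonneg_right h₁.le hv₀).trans huv
    rwa [inv_mul_le_iff₀ (by positivity)] at h
  · refine ⟨J, Finset.mem_range.2 (by omega), h, ?_⟩
    rw [pow_succ]
    nlinarith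

theorem mem_Icc_of_abs_mul_sub_lt_one {q : ℕ} {p : ℤ} {t : ℝ} (ht : t ∈ Set.Ico (0 : ℝ) 1)
    (h : |(q : ℝ) * t - p| < 1) : p ∈ Finset.Icc (0 : ℤ) q := by
  obtain ⟨h₁, h₂⟩ := abs_lt.1 h
  have hq : (0 : ℝ) ≤ q := q.cast_nonneg
  have h₃ : (0 : ℝ) ≤ q * t := mul_nonneg hq ht.1
  have h₄ : (q : ℝ) * t ≤ q := mul_le_of_le_one_right hq ht.2.le
  have h₅ : (-1 : ℝ) < p := by linarith
  have h₆ : (p : ℝ) < q + 1 := by linarith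
  rw [Finset.mem_Icc]
  constructor
  · have : (-1 : ℤ) < p := by exact_mod_cast h₅
    omega
  · have : p < (q : ℤ) + 1 := by exact_mod_cast h₆
    omega

theorem volume_setOf_abs_mul_sub_le {q : ℝ} (hq : 0 < q) (p r : ℝ) :
    volume {t : ℝ | |q * t - p| ≤ r} = ENNReal.ofReal (2 * r / q) := by
  have : {t : ℝ | |q * t - p| ≤ r} = Set.Icc ((p - r) / q) ((p + r) / q) := by
    ext t
    rw [Set.mem_ofPred_eq, abs_le, Set.mem_Icc, div_le_iff₀ hq, le_div_iff₀ hq]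
    constructor <;> rintro ⟨h₁, h₂⟩ <;> constructor <;> linarith
  rw [this, Real.volume_Icc]
  congr 1
  ring

theorem volume_approxSet_le {c ε : ℝ} {q J : ℕ} (hc : c < 1) (hq : 0 < q) (hε : 0 ≤ ε)
    (hJ : 1 ≤ 2 ^ J * ε) :
    volume (approxSet c ε q) ≤ ENNReal.ofReal (32 * (J + 1) * ε) := by
  have hq' : (0 : ℝ) < q := by exact_mod_cast hq
  have hq₁ : (1 : ℝ) ≤ q := by exact_mod_cast hq
  set I := (Finset.Icc (0 : ℤ) q ×ˢ Finset.Icc (0 : ℤ) q) ×ˢ Finset.range (J + 1) with hI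
  have hcover : approxSet c ε q ⊆ ⋃ i ∈ I,
      {t : ℝ | |(q : ℝ) * t - (i.1.1 : ℝ)| ≤ (2 ^ i.2 : ℝ)⁻¹} ×ˢ
      {t : ℝ | |(q : ℝ) * t - (i.1.2 : ℝ)| ≤ 2 ^ (i.2 + 1) * ε} := by
    rintro x ⟨⟨hx₁, hx₂⟩, p₁, p₂, h, h₁, h₂⟩
    obtain ⟨j, hj, hj₁, hj₂⟩ := exists_dyadic_rectangle (h₁.trans hc.le) (abs_nonneg _)
      (h₂.trans hc.le) h hJ
    simp only [Set.mem_iUnion]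
    exact ⟨((p₁, p₂), j), Finset.mk_mem_product (Finset.mk_mem_product
      (mem_Icc_of_abs_mul_sub_lt_one hx₁ (h₁.trans_lt hc))
      (mem_Icc_of_abs_mul_sub_lt_one hx₂ (h₂.trans_lt hc))) hj, hj₁, hj₂⟩
  refine (measure_mono hcover).trans ((measure_biUnion_finset_le _ _).trans ?_)
  have hrect : ∀ i ∈ I, volume ({t : ℝ | |(q : ℝ) * t - (i.1.1 : ℝ)| ≤ (2 ^ i.2 : ℝ)⁻¹} ×ˢ
      {t : ℝ | |(q : ℝ) * t - (i.1.2 : ℝ)| ≤ 2 ^ (i.2 + 1) * ε}) =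
      ENNReal.ofReal (8 * ε / q ^ 2) := by
    intro i _
    rw [Measure.volume_eq_prod, Measure.prod_prod, volume_setOf_abs_mul_sub_le hq',
      volume_setOf_abs_mul_sub_le hq', ← ENNReal.ofReal_mul (by positivity)]
    congr 1
    field_simp
    ring
  have hcard : I.card = (q + 1) * (q + 1) * (J + 1) := by
    rw [hI, Finset.card_product, Finset.card_product, Int.card_Icc, Finset.card_range]
    congr 2
  rw [Finset.sum_congr rfl hrect, Finset.sum_const, hcard, ← ENNReal.ofReal_nsmul]
  apply ENNReal.ofReal_le_ofReal
  rw [nsmul_eq_mul]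
  push_cast
  rw [← mul_div_assoc, div_le_iff₀ (by positivity)]
  have h : ((q : ℝ) + 1) * (q + 1) ≤ 4 * q ^ 2 := by nlinarith
  calc ((q : ℝ) + 1) * (q + 1) * (J + 1) * (8 * ε)
      = ((q + 1) * (q + 1)) * ((J + 1) * (8 * ε)) := by ring
    _ ≤ (4 * q ^ 2) * ((J + 1) * (8 * ε)) := by gcongr
    _ = 32 * (J + 1) * ε * q ^ 2 := by ring

theorem summable_natLog_rpow_div {s : ℝ} (hs : 1 < s) :
    Summable fun q : ℕ => ((Nat.log 2 q : ℝ) + 1) ^ (-s) * (q : ℝ)⁻¹ := by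
  rw [← summable_condensed_iff_of_nonneg]
  · have h : Summable fun k : ℕ => (((k + 1 : ℕ) : ℝ)) ^ (-s) :=
      (summable_nat_add_iff 1).2 (Real.summable_nat_rpow.2 (by linarith))
    refine h.congr fun k => ?_
    rw [Nat.log_pow one_lt_two]
    push_cast
    field_simp
  · intro n
    positivity
  · intro m n hm hmn
    have hm' : (0 : ℝ) < m := by exact_mod_cast hm
    have hlog : (Nat.log 2 m : ℝ) ≤ Nat.log 2 n := by exact_mod_cast Nat.log_mono_right hmn
    have hmn' : (m : ℝ) ≤ n := by exact_mod_cast hmn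
    refine mul_le_mul ?_ (inv_anti₀ hm' hmn') (by positivity) (by positivity)
    exact Real.rpow_le_rpow_of_nonpos (by positivity) (by linarith) (by linarith)

theorem natLog_add_one_div_four_le_log {q : ℕ} (hq : 2 ≤ q) :
    ((Nat.log 2 q : ℝ) + 1) / 4 ≤ Real.log q := by
  have h : (1 : ℝ) ≤ Nat.log 2 q := by
    exact_mod_cast Nat.log_pos one_lt_two hq
  have h₂ : ((2 : ℝ) ^ Nat.log 2 q) ≤ q := by
    exact_mod_cast Nat.pow_log_le_self 2 (by omega)
  have h₃ := Real.log_le_log (by positivity) h₂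
  rw [Real.log_pow] at h₃
  nlinarith [Real.log_two_gt_d9]

theorem one_le_two_pow_mul_log_rpow {K : ℝ} (hK : 0 ≤ K) {q : ℕ} (hq : 2 ≤ q) :
    1 ≤ 2 ^ ((Nat.log 2 q + 1) * (⌈K⌉₊ + 1)) * (Real.log q ^ (-K) * (q : ℝ)⁻¹) := by
  have hq₁ : (1 : ℝ) < q := by exact_mod_cast hq
  have hlog : 0 < Real.log q := Real.log_pos hq₁
  have hpow : (q : ℝ) ≤ 2 ^ (Nat.log 2 q + 1) := by
    exact_mod_cast (Nat.lt_pow_succ_log_self one_lt_two q).le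
  have h : Real.log q ^ K * q ≤ 2 ^ ((Nat.log 2 q + 1) * (⌈K⌉₊ + 1)) := by
    calc Real.log q ^ K * q ≤ (q : ℝ) ^ K * q := by
          gcongr
          exact Real.log_le_self (by positivity)
      _ ≤ (q : ℝ) ^ (⌈K⌉₊ : ℝ) * q := by
          gcongr
          · exact hq₁.le
          · exact Nat.le_ceil K
      _ = (q : ℝ) ^ (⌈K⌉₊ + 1) := by rw [Real.rpow_natCast, pow_succ]
      _ ≤ (2 ^ (Nat.log 2 q + 1)) ^ (⌈K⌉₊ + 1) := by gcongr
      _ = _ := by rw [← pow_mul]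
  rw [Real.rpow_neg hlog.le, ← mul_inv, ← div_eq_mul_inv, one_le_div (by positivity)]
  exact h

theorem volume_approxSet_log_le {c K : ℝ} (hc : c < 1) (hK : 0 ≤ K) {q : ℕ} (hq : 2 ≤ q) :
    volume (approxSet c (Real.log q ^ (-K) * (q : ℝ)⁻¹) q) ≤
      ENNReal.ofReal (32 * (⌈K⌉₊ + 2) * 4 ^ K *
        (((Nat.log 2 q : ℝ) + 1) ^ (-(K - 1)) * (q : ℝ)⁻¹)) := by
  have hlog : 0 < Real.log q := Real.log_pos (by exact_mod_cast hq)
  refine (volume_approxSet_le hc (by omega) (by positivity)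
    (one_le_two_pow_mul_log_rpow hK hq)).trans (ENNReal.ofReal_le_ofReal ?_)
  set L : ℝ := (Nat.log 2 q : ℝ) + 1 with hL
  have hL₁ : 1 ≤ L := by simp [hL]
  have hrpow : Real.log q ^ (-K) ≤ 4 ^ K * L ^ (-K) := by
    calc Real.log q ^ (-K) ≤ (L / 4) ^ (-K) :=
          Real.rpow_le_rpow_of_nonpos (by positivity) (natLog_add_one_div_four_le_log hq)
            (by linarith)
      _ = 4 ^ K * L ^ (-K) := by
          rw [Real.div_rpow (by positivity) (by norm_num),
            Real.rpow_neg (by norm_num : (0 : ℝ) ≤ 4), div_inv_eq_mul, mul_comm]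
  have hJ : ((((Nat.log 2 q + 1) * (⌈K⌉₊ + 1) : ℕ) : ℝ) + 1) ≤ (⌈K⌉₊ + 2) * L := by
    push_cast
    rw [← hL]
    linarith
  calc 32 * ((((Nat.log 2 q + 1) * (⌈K⌉₊ + 1) : ℕ) : ℝ) + 1) * (Real.log q ^ (-K) * (q : ℝ)⁻¹)
      ≤ 32 * ((⌈K⌉₊ + 2) * L) * ((4 ^ K * L ^ (-K)) * (q : ℝ)⁻¹) := by gcongr
    _ = 32 * (⌈K⌉₊ + 2) * 4 ^ K * ((L ^ (-K) * L) * (q : ℝ)⁻¹) := by ring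
    _ = _ := by
      rw [← Real.rpow_add_one (by positivity)]
      ring_nf

theorem stmt18 (c : ℝ) (hc : c ∈ Set.Ioo (0:ℝ) 1) (K : ℝ) (hK : 2 < K) :
    ∀ᵐ x : ℝ × ℝ ∂(volume.restrict box2),
      {q : ℕ | 2 ≤ q ∧ ∃ p₁ p₂ : ℤ,
        |(q : ℝ) * x.1 - (p₁ : ℝ)| * |(q : ℝ) * x.2 - (p₂ : ℝ)| ≤
          Real.log q ^ (-K) * (q : ℝ)⁻¹ ∧
        |(q : ℝ) * x.1 - (p₁ : ℝ)| ≤ c ∧ |(q : ℝ) * x.2 - (p₂ : ℝ)| ≤ c}.Finite := by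
  set A : ℕ → Set (ℝ × ℝ) := fun q =>
    {x | 2 ≤ q ∧ x ∈ approxSet c (Real.log q ^ (-K) * (q : ℝ)⁻¹) q} with hA
  have hsum : ∑' q, volume (A q) ≠ ⊤ := by
    refine ne_top_of_le_ne_top ((summable_natLog_rpow_div (s := K - 1) (by linarith)).mul_left
      (32 * (⌈K⌉₊ + 2) * (4 : ℝ) ^ K)).tsum_ofReal_ne_top (ENNReal.tsum_le_tsum fun q => ?_)
    by_cases hq : 2 ≤ q
    · simpa [hA, hq] using volume_approxSet_log_le hc.2 (by linarith) hq
    · simp [hA, hq]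
  have hbox2 : MeasurableSet box2 := measurableSet_Ico.prod measurableSet_Ico
  rw [ae_restrict_iff' hbox2]
  filter_upwards [ae_finite_setOfPred_mem hsum] with x hx hbox
  exact hx.subset fun q hq => ⟨hq.1, hbox, hq.2⟩

end
end
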